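/- Let n ≥ 2, let d_1 = (d_{11},p_1) ∈ ℚ² and d_i (2 ≤ i ≤ n−1) be rational data, and let 2 ≤ j ≤ n. Assume the rings R^{D}_{h_{j−1}} and R^{D}_{h_j} are Artinian (finite dimensional over ℝ). Then multiplication by x_1−x_j induces a well-defined injective ℝ-linear map R^{D}_{h_{j−1}} → R^{D}_{h_j}, and the cokernel R^{D}_{h_j}/(x_1−x_j) is isomorphic to a ring R^{D'_{(n−1)}} := ℝ[x_2,…,x_n]/(f^{d'_1}_{1,2(n−1)−2},…,f^{d'_{n−2}}_{n−2,n}, x_2···x_n) for some rational data D'_{(n−1)}; that is, there is a short exact sequence 0 → R^{D}_{h_{j−1}} → R^{D}_{h_j} → R^{D'_{(n−1)}} → 0. -/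

import Mathlib

open MvPolynomial

noncomputable section

/-- The variable `x_k` (1-indexed) of `ℝ[x_1,…,x_n]`. -/
def xv (n : ℕ) (k : ℕ) : MvPolynomial (Fin n) ℝ :=
  if h : 1 ≤ k ∧ k ≤ n then X ⟨k - 1, by omega⟩ else 0

/-- `f^{d_i}_{i,2n−1−i} = Σ_{k=1}^{i} d_{ik}·(x_k²−x_{i+1}²)···(x_k²−x_n²)
 + (−1)^{n−i+1}·p_i·x_{i+1}²···x_n²` for `i ≥ 1`, with `f^{d_0}_{0,2n−1} = x_1²···x_n²`. -/
def fDd (n : ℕ) (d : ℕ → ℕ → ℚ) (p : ℕ → ℚ) (i : ℕ) : MvPolynomial (Fin n) ℝ :=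
  if i = 0 then ∏ ℓ ∈ Finset.Icc 1 n, xv n ℓ ^ 2
  else
    (∑ k ∈ Finset.Icc 1 i,
        (d i k : ℝ) • ∏ ℓ ∈ Finset.Icc (i + 1) n, (xv n k ^ 2 - xv n ℓ ^ 2)) +
      ((-1 : ℝ) ^ (n - i + 1) * (p i : ℝ)) • ∏ ℓ ∈ Finset.Icc (i + 1) n, xv n ℓ ^ 2

/-- The polynomial `f^{d_1}_{1,j}` for `1 ≤ j ≤ 2n−2`. -/
def fD1 (n : ℕ) (d11 p1 : ℚ) (j : ℕ) : MvPolynomial (Fin n) ℝ :=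
  if j ≤ n - 2 then
    (d11 : ℝ) • ((∏ ℓ ∈ Finset.Icc 2 j, (xv n 1 - xv n ℓ)) * xv n 1)
  else if j = n - 1 then
    (d11 : ℝ) • ((∏ ℓ ∈ Finset.Icc 2 (n - 1), (xv n 1 - xv n ℓ)) * (xv n 1 + xv n n)) +
      ((-1 : ℝ) ^ (n - 1) * (p1 : ℝ)) • ∏ ℓ ∈ Finset.Icc 2 n, xv n ℓ
  else
    (d11 : ℝ) • ((∏ ℓ ∈ Finset.Icc 2 (n - 1 - (j - n)), (xv n 1 - xv n ℓ)) *
        ∏ t ∈ Finset.Icc (n - (j - n)) n, (xv n 1 ^ 2 - xv n t ^ 2)) +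
      ((-1 : ℝ) ^ n * (p1 : ℝ)) • ((∏ ℓ ∈ Finset.Icc 2 (n - 1 - (j - n)), xv n ℓ) *
        ∏ t ∈ Finset.Icc (n - (j - n)) n, xv n t ^ 2)

/-- The polynomial `f^{d_1}_{n,2n−2} = d_{11}(x_1−x_2)···(x_1−x_n) + (−1)^n·p_1·x_2···x_n`. -/
def fDnLast (n : ℕ) (d11 p1 : ℚ) : MvPolynomial (Fin n) ℝ :=
  (d11 : ℝ) • (∏ ℓ ∈ Finset.Icc 2 n, (xv n 1 - xv n ℓ)) +
    ((-1 : ℝ) ^ n * (p1 : ℝ)) • ∏ ℓ ∈ Finset.Icc 2 n, xv n ℓ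

/-- The defining ideal of `R^{D}_{h_j}`: generated by `f^{d_1}_{1,j}`, the
`f^{d_i}_{i,2n−1−i}` for `2 ≤ i ≤ n−1`, and `f^{d_1}_{n,2n−2}`. -/
def IDhj (n : ℕ) (d11 p1 : ℚ) (d : ℕ → ℕ → ℚ) (p : ℕ → ℚ) (j : ℕ) :
    Ideal (MvPolynomial (Fin n) ℝ) :=
  Ideal.span
    ({fD1 n d11 p1 j, fDnLast n d11 p1} ∪ (fun i => fDd n d p i) '' Set.Icc 2 (n - 1))

/-- The defining ideal of `R^{D'_{(n−1)}}` in `n−1` variables: generated by the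
`f^{d'_i}_{i,2(n−1)−1−i}` for `1 ≤ i ≤ n−2` together with the product of all variables. -/
def IDn' (m : ℕ) (d : ℕ → ℕ → ℚ) (p : ℕ → ℚ) : Ideal (MvPolynomial (Fin m) ℝ) :=
  Ideal.span
    (insert (∏ ℓ ∈ Finset.Icc 1 m, xv m ℓ) ((fun i => fDd m d p i) '' Set.Icc 1 (m - 1)))

section Depth

open CategoryTheory Abelian IsLocalRing Module Pointwise RingTheory.Sequence

universe u

variable {R : Type u} [CommRing R] [IsLocalRing R]

/-- `M` has depth at least `d`: `Ext^i(k, M) = 0` for `i < d`, with `k` the residue field. -/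
def DepthGE (M : Type u) [AddCommGroup M] [Module R M] (d : ℕ) : Prop :=
  ∀ i < d, Subsingleton
    (Ext (ModuleCat.of R (ResidueField R)) (ModuleCat.of R M) i)

variable {M : Type u} [AddCommGroup M] [Module R M]

lemma DepthGE.quotSMulTop {d : ℕ} (h : DepthGE (R := R) M (d + 1)) {z : R}
    (hz : IsSMulRegular M z) : DepthGE (R := R) (QuotSMulTop z M) d := by
  intro i hi
  have hS := IsSMulRegular.smulShortComplex_shortExact (M := ModuleCat.of R M) hz
  refine subsingleton_of_forall_eq 0 fun x => ?_
  have h1 := h (i + 1) (by omega)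
  have h0 := h i (by omega)
  obtain ⟨y, hy⟩ := Ext.covariant_sequence_exact₃ (ModuleCat.of R (ResidueField R)) hS x rfl
    (@Subsingleton.elim _ h1 _ _)
  rw [← hy]
  exact (congrArg (fun y => Ext.comp y _ _) (@Subsingleton.elim _ h0 y 0)).trans (Ext.zero_comp ..)

lemma ext_residueField_smul_eq_zero {z : R} (hz : z ∈ maximalIdeal R) {i : ℕ}
    (x : Ext (ModuleCat.of R (ResidueField R)) (ModuleCat.of R M) i) : z • x = 0 := by
  have h : z • 𝟙 (ModuleCat.of R (ResidueField R)) = 0 := by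
    ext a
    change z • a = 0
    rw [Algebra.smul_def]
    simp [(residue_eq_zero_iff z).mpr hz]
  rw [← Ext.mk₀_id_comp x, ← Ext.smul_comp, ← Ext.mk₀_smul, h]
  simp

lemma DepthGE.of_quotSMulTop {d : ℕ} {z : R} (hz : IsSMulRegular M z) (hm : z ∈ maximalIdeal R)
    (h : DepthGE (R := R) (QuotSMulTop z M) d) : DepthGE (R := R) M (d + 1) := by
  intro i hi
  have hS := IsSMulRegular.smulShortComplex_shortExact (M := ModuleCat.of R M) hz
  refine subsingleton_of_forall_eq 0 fun x => ?_
  have key : x.comp (Ext.mk₀ (ModuleCat.smulShortComplex (ModuleCat.of R M) z).f)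
      (add_zero i) = 0 := by
    rw [ModuleCat.smulShortComplex_f_eq_smul_id]
    exact (Ext.smul_eq_comp_mk₀ x z).symm.trans (ext_residueField_smul_eq_zero hm x)
  cases i with
  | zero =>
    have := hS.mono_f
    refine Ext.postcomp_mk₀_injective_of_mono _
      (ModuleCat.smulShortComplex (ModuleCat.of R M) z).f ?_
    exact key.trans (map_zero _).symm
  | succ i =>
    obtain ⟨y, hy⟩ := Ext.covariant_sequence_exact₁ (ModuleCat.of R (ResidueField R)) hS x key rfl
    have h0 := h i (by omega)
    rw [← hy]
    exact (congrArg (fun y => Ext.comp y _ _) (@Subsingleton.elim _ h0 y 0)).trans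
      (Ext.zero_comp ..)

lemma depthGE_of_isWeaklyRegular {rs : List R} (hm : ∀ r ∈ rs, r ∈ maximalIdeal R)
    (h : IsWeaklyRegular M rs) : DepthGE (R := R) M rs.length := by
  induction rs generalizing M with
  | nil => exact fun i hi => absurd hi (by simp)
  | cons r rs ih =>
    rw [isWeaklyRegular_cons_iff] at h
    exact .of_quotSMulTop h.1 (hm r (by simp)) (ih (fun r hr => hm r (by simp [hr])) h.2)

variable [IsNoetherianRing R]

lemma DepthGE.exists_isSMulRegular [Module.Finite R M] {d : ℕ}
    (h : DepthGE (R := R) M (d + 1)) : ∃ z ∈ maximalIdeal R, IsSMulRegular M z := by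
  have h0 := h 0 (by omega)
  have h1 : Subsingleton (ResidueField R →ₗ[R] M) :=
    (ModuleCat.homEquiv (M := ModuleCat.of R (ResidueField R))
      (N := ModuleCat.of R M)).symm.subsingleton_congr.mpr
      (Ext.homEquiv₀.symm.subsingleton_congr.mpr h0)
  obtain ⟨z, hz, hreg⟩ := IsSMulRegular.subsingleton_linearMap_iff.mp h1
  refine ⟨z, ?_, hreg⟩
  exact (Ideal.annihilator_quotient (I := maximalIdeal R)).le hz

/-- If `z` is `M`-regular, every associated prime of `M` is contained in an associated prime of
`M / zM` that contains `z`. -/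
lemma exists_associatedPrime_quotSMulTop [Module.Finite R M] {z : R} (hz : IsSMulRegular M z)
    (hm : z ∈ maximalIdeal R) {P : Ideal R} (hP : IsAssociatedPrime P M) :
    ∃ Q : Ideal R, IsAssociatedPrime Q (QuotSMulTop z M) ∧ P ≤ Q ∧ z ∈ Q := by
  obtain ⟨hPp, u, hu⟩ := isAssociatedPrime_iff.mp hP
  have hu0 : u ≠ 0 := by
    rintro rfl
    exact hPp.ne_top (by rw [hu]; ext; simp)
  have hk : ∃ k : ℕ, ∃ v : M, u = z ^ k • v ∧ v ∉ z • (⊤ : Submodule R M) := by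
    by_contra! hcon
    have hpow (k : ℕ) : ∃ v : M, u = z ^ k • v := by
      induction k with
      | zero => exact ⟨u, by simp⟩
      | succ k ih =>
        obtain ⟨v, hv⟩ := ih
        obtain ⟨w, -, hw⟩ := (Submodule.mem_smul_pointwise_iff_exists _ _ _).mp (hcon k v hv)
        exact ⟨w, by rw [hv, ← hw, pow_succ, mul_smul]⟩
    have hbot := Ideal.iInf_pow_smul_eq_bot_of_isLocalRing (M := M) (maximalIdeal R)
      (IsLocalRing.maximalIdeal.isMaximal R).ne_top
    apply hu0
    rw [← Submodule.mem_bot R, ← hbot, Submodule.mem_iInf]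
    intro k
    obtain ⟨v, hv⟩ := hpow k
    rw [hv]
    exact Submodule.smul_mem_smul (Ideal.pow_mem_pow hm k) trivial
  obtain ⟨k, v, huv, hv⟩ := hk
  obtain ⟨Q, hQ, hle⟩ := exists_le_isAssociatedPrime_of_isNoetherianRing (R := R)
    (Submodule.Quotient.mk (p := z • (⊤ : Submodule R M)) v)
    (by rwa [Ne, Submodule.Quotient.mk_eq_zero])
  refine ⟨Q, hQ, fun a ha => hle ?_, hle ?_⟩
  · rw [hu, Submodule.mem_colon_singleton, Submodule.mem_bot, huv, smul_comm] at ha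
    have hav : a • v = 0 := hz.pow k (by simpa using ha)
    rw [Submodule.mem_colon_singleton, ← Submodule.Quotient.mk_smul, hav]
    simp
  · rw [Submodule.mem_colon_singleton, ← Submodule.Quotient.mk_smul, Submodule.mem_bot,
      Submodule.Quotient.mk_eq_zero]
    exact Submodule.smul_mem_pointwise_smul _ _ _ trivial

lemma supportDim_quotient_add_one_le {P Q : Ideal R} [P.IsPrime] [Q.IsPrime] (h : P < Q) :
    supportDim R (R ⧸ Q) + 1 ≤ supportDim R (R ⧸ P) := by
  obtain ⟨z, hzQ, hzP⟩ := SetLike.exists_of_lt h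
  have hreg : IsSMulRegular (R ⧸ P) z := by
    refine isSMulRegular_iff_right_eq_zero_of_smul.mpr fun a ha => ?_
    rw [Algebra.smul_def, mul_eq_zero] at ha
    exact ha.resolve_left fun h0 => hzP (Ideal.Quotient.eq_zero_iff_mem.mp h0)
  have hdim := supportDim_quotSMulTop_succ_eq_supportDim hreg
    (le_maximalIdeal (Ideal.IsPrime.ne_top ‹_›) hzQ)
  rw [← hdim]
  gcongr
  let f : (R ⧸ P) →ₗ[R] (R ⧸ Q) := Submodule.mapQ P Q LinearMap.id h.le
  have hf : Function.Surjective f := by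
    intro y
    obtain ⟨r, rfl⟩ := Submodule.Quotient.mk_surjective _ y
    exact ⟨Submodule.Quotient.mk r, rfl⟩
  refine supportDim_le_of_surjective
    (Submodule.liftQ (z • (⊤ : Submodule R (R ⧸ P))) f ?_) ?_
  · intro y hy
    obtain ⟨w, -, rfl⟩ := (Submodule.mem_smul_pointwise_iff_exists _ _ _).mp hy
    rw [LinearMap.mem_ker, map_smul]
    obtain ⟨r, hr⟩ := Submodule.Quotient.mk_surjective _ (f w)
    rw [← hr, ← Submodule.Quotient.mk_smul, Submodule.Quotient.mk_eq_zero]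
    exact Q.mul_mem_right _ hzQ
  · intro y
    obtain ⟨x, rfl⟩ := hf y
    exact ⟨Submodule.Quotient.mk x, rfl⟩

/-- The depth of `M` is at most the dimension of `R / P`, for every associated prime `P`. -/
lemma DepthGE.le_supportDim [Module.Finite R M] {d : ℕ} (h : DepthGE (R := R) M d)
    {P : Ideal R} (hP : IsAssociatedPrime P M) : (d : WithBot ℕ∞) ≤ supportDim R (R ⧸ P) := by
  induction d generalizing M P with
  | zero =>
    have := hP.isPrime
    have : Nontrivial (R ⧸ P) := Ideal.Quotient.nontrivial_iff.mpr this.ne_top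
    rw [supportDim_quotient_eq_ringKrullDim]
    exact_mod_cast ringKrullDim_nonneg_of_nontrivial
  | succ d ih =>
    obtain ⟨z, hm, hz⟩ := h.exists_isSMulRegular
    obtain ⟨Q, hQ, hPQ, hzQ⟩ := exists_associatedPrime_quotSMulTop hz hm hP
    have := hP.isPrime
    have := hQ.isPrime
    have hzP : z ∉ P := fun hzP => by
      have : z ∈ ⋃ p ∈ associatedPrimes R M, (p : Set R) := Set.mem_biUnion hP hzP
      rw [biUnion_associatedPrimes_eq_compl_regular] at this
      exact this hz
    have hlt : P < Q := lt_of_le_of_ne hPQ fun h => hzP (h ▸ hzQ)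
    refine le_trans ?_ (supportDim_quotient_add_one_le hlt)
    push_cast
    gcongr
    exact ih (h.quotSMulTop hz) hQ

lemma supportDim_le_length [Module.Finite R M] {fs : List R}
    (hm : ∀ f ∈ fs, f ∈ maximalIdeal R)
    (h : ∀ Q ∈ support R M, (∀ f ∈ fs, f ∈ Q.asIdeal) → Q.asIdeal = maximalIdeal R) :
    supportDim R M ≤ fs.length := by
  induction fs generalizing M with
  | nil =>
    have : Subsingleton (support R M) := by
      refine ⟨fun a b => Subtype.ext (PrimeSpectrum.ext ?_)⟩
      rw [h a a.2 (by simp), h b b.2 (by simp)]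
    simpa [supportDim] using Order.krullDim_nonpos_of_subsingleton
  | cons f fs ih =>
    refine (supportDim_le_supportDim_quotSMulTop_succ (hm f (by simp))).trans ?_
    rw [List.length_cons]
    push_cast
    gcongr
    refine ih (fun r hr => hm r (by simp [hr])) fun Q hQ hf => ?_
    rw [support_quotSMulTop] at hQ
    refine h Q hQ.1 ?_
    simpa using ⟨by simpa using hQ.2, hf⟩

/-- In a module of depth at least `d`, `d` elements that cut its support down to the closed point
form a weakly regular sequence. -/
theorem DepthGE.isWeaklyRegular [Module.Finite R M] {fs : List R}
    (hd : DepthGE (R := R) M fs.length) (hm : ∀ f ∈ fs, f ∈ maximalIdeal R)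
    (h : ∀ Q ∈ support R M, (∀ f ∈ fs, f ∈ Q.asIdeal) → Q.asIdeal = maximalIdeal R) :
    IsWeaklyRegular M fs := by
  induction fs generalizing M with
  | nil => simp
  | cons f fs ih =>
    have hreg : IsSMulRegular M f := by
      by_contra hf
      have hf' : f ∈ ⋃ p ∈ associatedPrimes R M, (p : Set R) := by
        rw [biUnion_associatedPrimes_eq_compl_regular]
        exact hf
      obtain ⟨P, hP, hfP⟩ := Set.mem_iUnion₂.mp hf'
      have hle := hd.le_supportDim hP
      have hPp := hP.isPrime
      have hub : supportDim R (R ⧸ P) ≤ fs.length := by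
        refine supportDim_le_length (fun r hr => hm r (by simp [hr])) fun Q hQ hfs => ?_
        have hPQ : P ≤ Q.asIdeal := by
          rw [mem_support_iff_of_finite, Ideal.annihilator_quotient] at hQ
          exact hQ
        refine h Q ?_ ?_
        · rw [mem_support_iff_of_finite]
          exact Submodule.annihilator_top.ge.trans (hP.annihilator_le.trans hPQ)
        · simpa using ⟨hPQ hfP, hfs⟩
      have := hle.trans hub
      rw [List.length_cons] at this
      norm_cast at this
      omega
    rw [isWeaklyRegular_cons_iff]
    refine ⟨hreg, ih (hd.quotSMulTop hreg) (fun r hr => hm r (by simp [hr])) fun Q hQ hf => ?_⟩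
    rw [support_quotSMulTop] at hQ
    refine h Q hQ.1 ?_
    simpa using ⟨by simpa using hQ.2, hf⟩

end Depth
section HomogeneousParameters

open IsLocalRing RingTheory.Sequence

variable {n : ℕ} {K : Type*} [Field K]

attribute [local instance] MvPolynomial.gradedAlgebra

lemma isWeaklyRegular_ofFn_X :
    IsWeaklyRegular (MvPolynomial (Fin n) K)
      (List.ofFn (X : Fin n → MvPolynomial (Fin n) K)) := by
  rw [isWeaklyRegular_iff]
  intro i hi
  have hin : i < n := by simpa using hi
  have hspan : (Ideal.ofList ((List.ofFn (X : Fin n → MvPolynomial (Fin n) K)).take i) • ⊤ :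
      Submodule (MvPolynomial (Fin n) K) (MvPolynomial (Fin n) K)) =
      Ideal.span (X '' {k : Fin n | k.1 < i}) := by
    rw [smul_eq_mul, Ideal.mul_top, Ideal.ofList]
    congr 1
    ext f
    simp only [Set.mem_ofPred_eq, List.mem_take_iff_getElem, List.getElem_ofFn, Set.mem_image,
      List.length_ofFn]
    constructor
    · rintro ⟨k, hk, rfl⟩
      exact ⟨⟨k, by omega⟩, by simp; omega, rfl⟩
    · rintro ⟨k, hk, rfl⟩
      exact ⟨k, by have := k.2; omega, rfl⟩
  rw [hspan, isSMulRegular_quotient_iff_mem_of_smul_mem]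
  intro f hf
  rw [mem_ideal_span_X_image] at hf ⊢
  intro m hm
  obtain ⟨k, hk, hne⟩ := hf (Finsupp.single ⟨i, hin⟩ 1 + m) (by
    rw [List.getElem_ofFn, smul_eq_mul, mem_support_iff, coeff_X_mul]
    exact mem_support_iff.mp hm)
  refine ⟨k, hk, ?_⟩
  have hki : (⟨i, hin⟩ : Fin n) ≠ k := by
    rintro rfl
    simp at hk
  simpa [Finsupp.single_apply, hki] using hne

/-- The ideal of polynomials vanishing at the origin. -/
abbrev originIdeal (n : ℕ) (K : Type*) [Field K] : Ideal (MvPolynomial (Fin n) K) :=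
  RingHom.ker (constantCoeff : MvPolynomial (Fin n) K →+* K)

instance : (originIdeal n K).IsPrime := RingHom.ker_isPrime _

lemma originIdeal_le {Q : Ideal (MvPolynomial (Fin n) K)} (h : ∀ i, X i ∈ Q) :
    originIdeal n K ≤ Q := by
  intro f hf
  have : f ∈ Ideal.span (X '' (Set.univ : Set (Fin n))) := by
    rw [mem_ideal_span_X_image]
    intro m hm
    by_contra! hcon
    have : m = 0 := Finsupp.ext fun i => hcon i trivial
    subst this
    exact mem_support_iff.mp hm hf
  refine Ideal.span_le.mpr ?_ this
  rintro _ ⟨i, -, rfl⟩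
  exact h i

lemma eq_originIdeal {Q : Ideal (MvPolynomial (Fin n) K)} (hQ : Q ≠ ⊤) (h : ∀ i, X i ∈ Q) :
    Q = originIdeal n K :=
  ((RingHom.ker_isMaximal_of_surjective _ fun a => ⟨C a, by simp⟩ :
    (originIdeal n K).IsMaximal).eq_of_le hQ (originIdeal_le h)).symm

lemma X_mem_radical_of_finite {s : Set (MvPolynomial (Fin n) K)}
    (hs : ∀ f ∈ s, ∃ d, f.IsHomogeneous d)
    [Module.Finite K (MvPolynomial (Fin n) K ⧸ Ideal.span s)] (i : Fin n) :
    X i ∈ (Ideal.span s).radical := by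
  obtain ⟨p, hp, hp0⟩ := Algebra.IsIntegral.isIntegral (R := K)
    (Ideal.Quotient.mk (Ideal.span s) (X i))
  have hmem : Polynomial.aeval (X i : MvPolynomial (Fin n) K) p ∈ Ideal.span s := by
    rw [← Ideal.Quotient.eq_zero_iff_mem, ← Ideal.Quotient.mkₐ_eq_mk K,
      ← Polynomial.aeval_algHom_apply]
    exact hp0
  have hhom : (Ideal.span s).IsHomogeneous (homogeneousSubmodule (Fin n) K) :=
    Ideal.homogeneous_span _ _ hs
  have hcomp := homogeneousComponent_mem_of_mem hhom hmem p.natDegree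
  refine ⟨p.natDegree, ?_⟩
  convert hcomp
  rw [Polynomial.aeval_eq_sum_range, map_sum, Finset.sum_eq_single p.natDegree]
  · have : p.coeff p.natDegree = 1 := hp
    rw [this, one_smul, homogeneousComponent_of_mem (isHomogeneous_X_pow i _), if_pos rfl]
  · intro k _ hk
    rw [map_smul, homogeneousComponent_of_mem (isHomogeneous_X_pow i _), if_neg hk.symm,
      smul_zero]
  · simp

lemma mem_originIdeal_of_isHomogeneous {f : MvPolynomial (Fin n) K} {d : ℕ} (hd : d ≠ 0)
    (hf : f.IsHomogeneous d) : f ∈ originIdeal n K :=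
  hf.coeff_eq_zero (d := 0) (by simpa using hd.symm)

lemma depthGE_localization_originIdeal {K : Type} [Field K] :
    DepthGE (R := Localization.AtPrime (originIdeal n K))
      (Localization.AtPrime (originIdeal n K)) n := by
  have h := depthGE_of_isWeaklyRegular
    (R := Localization.AtPrime (originIdeal n K)) (rs := (List.ofFn X).map (algebraMap _ _))
    (by
      intro r hr
      obtain ⟨f, hf, rfl⟩ := List.mem_map.mp hr
      obtain ⟨i, rfl⟩ := List.mem_ofFn.mp hf
      rw [IsLocalization.AtPrime.to_map_mem_maximal_iff _ (originIdeal n K)]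
      simp)
    (isWeaklyRegular_ofFn_X.of_isLocalization _ (originIdeal n K).primeCompl)
  simpa using h

lemma eq_maximalIdeal_of_X_mem_radical {s : Set (MvPolynomial (Fin n) K)}
    (hs : ∀ i, X i ∈ (Ideal.span s).radical)
    (Q : Ideal (Localization.AtPrime (originIdeal n K))) [hQ : Q.IsPrime]
    (h : ∀ f ∈ s, algebraMap _ (Localization.AtPrime (originIdeal n K)) f ∈ Q) :
    Q = maximalIdeal (Localization.AtPrime (originIdeal n K)) := by
  refine le_antisymm (le_maximalIdeal hQ.ne_top) ?_
  rw [← Localization.AtPrime.map_eq_maximalIdeal, Ideal.map_le_iff_le_comap]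
  refine originIdeal_le fun i => ?_
  have : Ideal.span s ≤ Q.comap (algebraMap _ _) := Ideal.span_le.mpr h
  exact (Ideal.IsPrime.radical_le_iff inferInstance).mpr this (hs i)

section

variable {K : Type} [Field K] {fs : List (MvPolynomial (Fin n) K)}

lemma map_mem_maximalIdeal (hom : ∀ f ∈ fs, ∃ d ≠ 0, f.IsHomogeneous d) :
    ∀ r ∈ fs.map (algebraMap _ (Localization.AtPrime (originIdeal n K))),
      r ∈ maximalIdeal (Localization.AtPrime (originIdeal n K)) := by
  intro r hr
  obtain ⟨f, hf, rfl⟩ := List.mem_map.mp hr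
  obtain ⟨d, hd, hfd⟩ := hom f hf
  rw [IsLocalization.AtPrime.to_map_mem_maximal_iff _ (originIdeal n K)]
  exact mem_originIdeal_of_isHomogeneous hd hfd

/-- At least `n` forms are needed to generate an ideal of finite colength in `n` variables. -/
theorem le_length_of_finite_quotient (hom : ∀ f ∈ fs, ∃ d ≠ 0, f.IsHomogeneous d)
    [Module.Finite K (MvPolynomial (Fin n) K ⧸ Ideal.ofList fs)] : n ≤ fs.length := by
  have hX := X_mem_radical_of_finite (s := {f | f ∈ fs})
    fun f hf => (hom f hf).imp fun _ h => h.2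
  have hub := supportDim_le_length (M := Localization.AtPrime (originIdeal n K))
    (map_mem_maximalIdeal hom) fun Q _ hfs =>
      eq_maximalIdeal_of_X_mem_radical hX Q.asIdeal fun f hf =>
        hfs _ (List.mem_map_of_mem hf)
  obtain ⟨P, hP⟩ := associatedPrimes.nonempty (Localization.AtPrime (originIdeal n K))
    (Localization.AtPrime (originIdeal n K))
  have hlb := (depthGE_localization_originIdeal (n := n) (K := K)).le_supportDim hP
  have := hlb.trans ((Module.supportDim_le_of_surjective (Submodule.mkQ P)
    (Submodule.mkQ_surjective P)).trans hub)
  rw [List.length_map] at this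
  exact_mod_cast this

/-- If `n` forms generate an ideal of finite colength in `n` variables, the last one is regular
modulo the others. -/
theorem mem_ofList_of_mul_mem {F : MvPolynomial (Fin n) K} (hlen : fs.length + 1 = n)
    (hom : ∀ f ∈ fs, ∃ d ≠ 0, f.IsHomogeneous d) (homF : ∃ d ≠ 0, F.IsHomogeneous d)
    [Module.Finite K (MvPolynomial (Fin n) K ⧸ Ideal.ofList (fs ++ [F]))]
    {h : MvPolynomial (Fin n) K} (hh : F * h ∈ Ideal.ofList fs) : h ∈ Ideal.ofList fs := by
  have hom' : ∀ f ∈ fs ++ [F], ∃ d ≠ 0, f.IsHomogeneous d := by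
    simpa [or_imp, forall_and] using ⟨by simpa using hom, by simpa using homF⟩
  have hX := X_mem_radical_of_finite (s := {f | f ∈ fs ++ [F]})
    fun f hf => (hom' f hf).imp fun _ h => h.2
  have hreg : IsWeaklyRegular (Localization.AtPrime (originIdeal n K))
      ((fs ++ [F]).map (algebraMap _ (Localization.AtPrime (originIdeal n K)))) := by
    refine DepthGE.isWeaklyRegular ?_ (map_mem_maximalIdeal hom') fun Q _ hfs =>
      eq_maximalIdeal_of_X_mem_radical hX Q.asIdeal fun f hf => hfs _ (List.mem_map_of_mem hf)
    simpa [hlen] using depthGE_localization_originIdeal (n := n) (K := K)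
  rw [List.map_append, isWeaklyRegular_append_iff, List.map_singleton,
    isWeaklyRegular_singleton_iff, isSMulRegular_quotient_iff_mem_of_smul_mem, smul_eq_mul,
    Ideal.mul_top, ← Ideal.map_ofList] at hreg
  have hloc := hreg.2 (algebraMap _ _ h) (by
    rw [smul_eq_mul, ← map_mul]
    exact Ideal.mem_map_of_mem _ hh)
  obtain ⟨s, hs, hsh⟩ := (IsLocalization.algebraMap_mem_map_algebraMap_iff
    (originIdeal n K).primeCompl _ _ _).mp hloc
  by_contra hcon
  let L : Ideal (MvPolynomial (Fin n) K) := (Ideal.ofList fs).colon {h}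
  have hL : L ≠ ⊤ := fun hL => hcon (by
    have : (1 : MvPolynomial (Fin n) K) ∈ L := hL ▸ trivial
    simpa [L, Submodule.mem_colon_singleton] using this)
  obtain ⟨Q, hQ, hLQ⟩ := Ideal.exists_le_maximal L hL
  have hle : Ideal.ofList (fs ++ [F]) ≤ Q := by
    rw [Ideal.ofList_append, Ideal.ofList_singleton, sup_le_iff, Ideal.span_singleton_le_iff_mem]
    refine ⟨fun f hf => hLQ ?_, hLQ ?_⟩
    · exact Submodule.mem_colon_singleton.mpr (Ideal.mul_mem_right _ _ hf)
    · exact Submodule.mem_colon_singleton.mpr hh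
  have hQe : Q = originIdeal n K := eq_originIdeal hQ.ne_top fun i =>
    (Ideal.IsPrime.radical_le_iff hQ.isPrime).mpr hle (hX i)
  exact hs (hQe ▸ hLQ (Submodule.mem_colon_singleton.mpr hsh))

end

end HomogeneousParameters

section ExactSequence

variable {n : ℕ} {d11 p1 : ℚ} {d : ℕ → ℕ → ℚ} {p : ℕ → ℚ} {j : ℕ}

/-- The product `d_{11}(x_1 - x_2)⋯(x_1 - x_j)x_1`. -/
def chainForm (n : ℕ) (d11 : ℚ) (j : ℕ) : MvPolynomial (Fin n) ℝ :=
  (d11 : ℝ) • ((∏ ℓ ∈ Finset.Icc 2 j, (xv n 1 - xv n ℓ)) * xv n 1)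

/-- The generators `f^{d_i}_{i,2n-1-i}` for `2 ≤ i ≤ n - 1`. -/
def middleForms (n : ℕ) (d : ℕ → ℕ → ℚ) (p : ℕ → ℚ) : List (MvPolynomial (Fin n) ℝ) :=
  (List.range (n - 2)).map fun t => fDd n d p (t + 2)

lemma length_middleForms : (middleForms n d p).length = n - 2 := by
  simp [middleForms]

lemma mem_middleForms {f : MvPolynomial (Fin n) ℝ} :
    f ∈ middleForms n d p ↔ ∃ i, 2 ≤ i ∧ i ≤ n - 1 ∧ fDd n d p i = f := by
  simp only [middleForms, List.mem_map, List.mem_range]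
  constructor
  · rintro ⟨t, ht, rfl⟩
    exact ⟨t + 2, by omega, by omega, rfl⟩
  · rintro ⟨i, h2, hi, rfl⟩
    exact ⟨i - 2, by omega, by rw [Nat.sub_add_cancel h2]⟩

lemma chainForm_succ (hj : 1 ≤ j) :
    chainForm n d11 (j + 1) = (xv n 1 - xv n (j + 1)) * chainForm n d11 j := by
  rw [chainForm, Finset.prod_Icc_succ_top (by omega), chainForm, mul_smul_comm]
  congr 1
  ring

lemma prod_Icc_two_eq {M : Type*} [CommMonoid M] (f : ℕ → M) (hn : 2 ≤ n) :
    ∏ ℓ ∈ Finset.Icc 2 n, f ℓ = (∏ ℓ ∈ Finset.Icc 2 (n - 1), f ℓ) * f n := by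
  obtain ⟨m, rfl⟩ := Nat.exists_eq_add_of_le' (show 1 ≤ n by omega)
  rw [Finset.prod_Icc_succ_top (by omega), Nat.add_sub_cancel]

lemma exists_fD1_eq (hn : 2 ≤ n) (hj : 1 ≤ j) (hjn : j ≤ n) :
    ∃ (u : ℝ) (a : MvPolynomial (Fin n) ℝ), u ≠ 0 ∧
      fD1 n d11 p1 j = C u * chainForm n d11 j + a * fDnLast n d11 p1 := by
  unfold fD1
  split_ifs with h1 h2
  · exact ⟨1, 0, one_ne_zero, by simp [chainForm]⟩
  · subst h2
    refine ⟨2, -1, two_ne_zero, ?_⟩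
    have hs : (-1 : ℝ) ^ (n - 1) = -(-1) ^ n := by
      obtain ⟨m, rfl⟩ := Nat.exists_eq_add_of_le' (show 1 ≤ n by omega)
      simp [pow_succ]
    simp only [chainForm, fDnLast, prod_Icc_two_eq _ hn, hs, smul_eq_C_mul, map_mul, map_neg,
      map_ofNat]
    ring
  · obtain rfl : j = n := by omega
    refine ⟨1, xv j j, one_ne_zero, ?_⟩
    simp only [chainForm, fDnLast, prod_Icc_two_eq _ hn, smul_eq_C_mul, map_mul, Nat.sub_self,
      Nat.sub_zero, Finset.Icc_self, Finset.prod_singleton, map_one]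
    ring

lemma IDhj_eq_ofList (hn : 2 ≤ n) (hj : 1 ≤ j) (hjn : j ≤ n) :
    IDhj n d11 p1 d p j =
      Ideal.ofList ((fDnLast n d11 p1 :: middleForms n d p) ++ [chainForm n d11 j]) := by
  obtain ⟨u, a, hu, hua⟩ := exists_fD1_eq (d11 := d11) (p1 := p1) hn hj hjn
  have hg : fDnLast n d11 p1 ∈ IDhj n d11 p1 d p j := Ideal.subset_span (by simp)
  have hg' : fDnLast n d11 p1 ∈
      Ideal.ofList ((fDnLast n d11 p1 :: middleForms n d p) ++ [chainForm n d11 j]) :=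
    Ideal.subset_span (by simp)
  apply le_antisymm
  · refine Ideal.span_le.mpr ?_
    rintro f ((rfl | rfl) | ⟨i, hi, rfl⟩)
    · rw [SetLike.mem_coe, hua]
      exact add_mem (Ideal.mul_mem_left _ _ (Ideal.subset_span (by simp)))
        (Ideal.mul_mem_left _ _ hg')
    · exact hg'
    · have := mem_middleForms (n := n) (d := d) (p := p).mpr ⟨i, hi.1, hi.2, rfl⟩
      exact Ideal.subset_span (by simp [this])
  · refine Ideal.span_le.mpr fun f hf => ?_
    simp only [List.cons_append, List.mem_cons, List.mem_append, List.not_mem_nil,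
      or_false, Set.mem_ofPred_eq] at hf
    obtain rfl | hf | rfl := hf
    · exact hg
    · obtain ⟨i, h2, hi, rfl⟩ := mem_middleForms.mp hf
      exact Ideal.subset_span (Or.inr ⟨i, ⟨h2, hi⟩, rfl⟩)
    · have h1 : fD1 n d11 p1 j ∈ IDhj n d11 p1 d p j := Ideal.subset_span (by simp)
      have h2 : chainForm n d11 j =
          C u⁻¹ * (fD1 n d11 p1 j - a * fDnLast n d11 p1) := by
        rw [hua, add_sub_cancel_right, ← mul_assoc, ← map_mul, inv_mul_cancel₀ hu, map_one,
          one_mul]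
      rw [SetLike.mem_coe, h2]
      exact Ideal.mul_mem_left _ _ (sub_mem h1 (Ideal.mul_mem_left _ _ hg))

lemma isHomogeneous_xv (n k : ℕ) : (xv n k).IsHomogeneous 1 := by
  unfold xv
  split_ifs
  · exact isHomogeneous_X _ _
  · exact isHomogeneous_zero _ _ _

lemma isHomogeneous_smul {σ : Type*} {f : MvPolynomial σ ℝ} {k : ℕ} (c : ℝ)
    (hf : f.IsHomogeneous k) : (c • f).IsHomogeneous k :=
  (homogeneousSubmodule σ ℝ k).smul_mem c hf

lemma isHomogeneous_prod_const {σ ι : Type*} {s : Finset ι} {f : ι → MvPolynomial σ ℝ} {k : ℕ}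
    (hf : ∀ i ∈ s, (f i).IsHomogeneous k) : (∏ i ∈ s, f i).IsHomogeneous (s.card * k) := by
  simpa using IsHomogeneous.prod s f (fun _ => k) hf

lemma isHomogeneous_chainForm (hj : 1 ≤ j) : (chainForm n d11 j).IsHomogeneous j := by
  have h := (isHomogeneous_prod_const (s := Finset.Icc 2 j) fun ℓ _ =>
    (isHomogeneous_xv n 1).sub (isHomogeneous_xv n ℓ)).mul (isHomogeneous_xv n 1)
  rw [Nat.card_Icc, show (j + 1 - 2) * 1 + 1 = j by omega] at h
  exact isHomogeneous_smul _ h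

lemma isHomogeneous_fDnLast : (fDnLast n d11 p1).IsHomogeneous (n - 1) := by
  have h1 := isHomogeneous_prod_const (s := Finset.Icc 2 n) fun ℓ _ =>
    (isHomogeneous_xv n 1).sub (isHomogeneous_xv n ℓ)
  have h2 := isHomogeneous_prod_const (s := Finset.Icc 2 n) fun ℓ _ => isHomogeneous_xv n ℓ
  rw [Nat.card_Icc, show (n + 1 - 2) * 1 = n - 1 by omega] at h1 h2
  exact (isHomogeneous_smul _ h1).add (isHomogeneous_smul _ h2)

lemma isHomogeneous_fDd {i : ℕ} (hi : i ≠ 0) : (fDd n d p i).IsHomogeneous ((n - i) * 2) := by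
  have hc : (Finset.Icc (i + 1) n).card = n - i := by
    rw [Nat.card_Icc, Nat.add_sub_add_right]
  have hsq (k : ℕ) : (xv n k ^ 2).IsHomogeneous 2 := (isHomogeneous_xv n k).pow 2
  rw [fDd, if_neg hi, ← hc]
  exact (IsHomogeneous.sum _ _ _ fun k _ => isHomogeneous_smul _
    (isHomogeneous_prod_const fun ℓ _ => (hsq k).sub (hsq ℓ))).add
    (isHomogeneous_smul _ (isHomogeneous_prod_const fun ℓ _ => hsq ℓ))

lemma isHomogeneous_of_mem_middleForms :
    ∀ f ∈ middleForms n d p, ∃ k ≠ 0, f.IsHomogeneous k := by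
  intro f hf
  obtain ⟨i, h2, hi, rfl⟩ := mem_middleForms.mp hf
  exact ⟨_, by omega, isHomogeneous_fDd (by omega)⟩

/-- Multiplication by `x_1 - x_j` from `R_{h_{j-1}}` to `R_{h_j}` is well defined and injective. -/
lemma mul_mem_IDhj_iff (hn : 2 ≤ n) (hj : 1 ≤ j) (hjn : j + 1 ≤ n)
    [Module.Finite ℝ (MvPolynomial (Fin n) ℝ ⧸ IDhj n d11 p1 d p (j + 1))]
    {f : MvPolynomial (Fin n) ℝ} :
    (xv n 1 - xv n (j + 1)) * f ∈ IDhj n d11 p1 d p (j + 1) ↔ f ∈ IDhj n d11 p1 d p j := by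
  have hfin : Module.Finite ℝ (MvPolynomial (Fin n) ℝ ⧸ Ideal.ofList
      ((fDnLast n d11 p1 :: middleForms n d p) ++ [chainForm n d11 (j + 1)])) := by
    rwa [← IDhj_eq_ofList hn (by omega) hjn]
  rw [IDhj_eq_ofList hn (by omega) hjn, IDhj_eq_ofList hn hj (by omega), Ideal.ofList_append,
    Ideal.ofList_append, Ideal.ofList_singleton, Ideal.ofList_singleton, chainForm_succ hj]
  rw [chainForm_succ hj] at hfin
  set J := Ideal.ofList (fDnLast n d11 p1 :: middleForms n d p)
  simp only [Submodule.mem_sup, Ideal.mem_span_singleton']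
  constructor
  · rintro ⟨y, hy, _, ⟨a, rfl⟩, hf⟩
    refine ⟨f - a * chainForm n d11 j, ?_, _, ⟨a, rfl⟩, by ring⟩
    refine mem_ofList_of_mul_mem (F := (xv n 1 - xv n (j + 1)) * chainForm n d11 j) ?_ ?_ ?_ ?_
    · rw [List.length_cons, length_middleForms]
      omega
    · intro g hg
      obtain rfl | hg := List.mem_cons.mp hg
      · exact ⟨_, by omega, isHomogeneous_fDnLast⟩
      · exact isHomogeneous_of_mem_middleForms g hg
    · rw [← chainForm_succ hj]
      exact ⟨j + 1, by omega, isHomogeneous_chainForm (by omega)⟩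
    · have h : (xv n 1 - xv n (j + 1)) * chainForm n d11 j * (f - a * chainForm n d11 j) =
          chainForm n d11 j * y := by
        linear_combination -(chainForm n d11 j) * hf
      rw [h]
      exact Ideal.mul_mem_left _ _ hy
  · rintro ⟨y, hy, _, ⟨a, rfl⟩, rfl⟩
    exact ⟨_, Ideal.mul_mem_left _ (xv n 1 - xv n (j + 1)) hy, _, ⟨a, rfl⟩, by ring⟩

lemma p1_ne_zero (hn : 2 ≤ n) (hj : 1 ≤ j) (hjn : j + 1 ≤ n)
    [Module.Finite ℝ (MvPolynomial (Fin n) ℝ ⧸ IDhj n d11 p1 d p (j + 1))] : p1 ≠ 0 := by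
  rintro rfl
  let fs := (xv n 1 - xv n (j + 1)) :: middleForms n d p
  have hx : xv n 1 - xv n (j + 1) ∈ Ideal.ofList fs := Ideal.subset_span (by simp [fs])
  have hle : IDhj n d11 0 d p (j + 1) ≤ Ideal.ofList fs := by
    rw [IDhj_eq_ofList hn (by omega) hjn]
    refine Ideal.span_le.mpr fun f hf => ?_
    simp only [List.cons_append, List.mem_cons, List.mem_append, List.not_mem_nil,
      or_false, Set.mem_ofPred_eq] at hf
    obtain rfl | hf | rfl := hf
    · rw [SetLike.mem_coe, fDnLast, Rat.cast_zero, mul_zero, zero_smul, add_zero, smul_eq_C_mul]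
      refine Ideal.mul_mem_left _ _ (Ideal.mem_of_dvd _ ?_ hx)
      exact Finset.dvd_prod_of_mem (fun ℓ => xv n 1 - xv n ℓ) (Finset.mem_Icc.mpr (by omega))
    · exact Ideal.subset_span (by simp [fs, hf])
    · rw [SetLike.mem_coe, chainForm_succ hj]
      exact Ideal.mul_mem_right _ _ hx
  have hfin : Module.Finite ℝ (MvPolynomial (Fin n) ℝ ⧸ Ideal.ofList fs) :=
    Module.Finite.of_surjective (Ideal.Quotient.factorₐ ℝ hle).toLinearMap
      (Ideal.Quotient.factor_surjective hle)
  have := le_length_of_finite_quotient (fs := fs) fun f hf => by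
    obtain rfl | hf := List.mem_cons.mp hf
    · exact ⟨1, one_ne_zero, (isHomogeneous_xv n _).sub (isHomogeneous_xv n _)⟩
    · exact isHomogeneous_of_mem_middleForms f hf
  rw [List.length_cons, length_middleForms] at this
  omega

variable {m c : ℕ}

/-- The homomorphism `ℝ[x_1,…,x_{m+1}] → ℝ[y_1,…,y_m]` sending `x_1` to `y_c` and `x_{k+1}`
to `y_k`. -/
def identifyVars (m c : ℕ) : MvPolynomial (Fin (m + 1)) ℝ →ₐ[ℝ] MvPolynomial (Fin m) ℝ :=
  aeval fun i => if i.1 = 0 then xv m c else xv m i.1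

/-- The homomorphism `ℝ[y_1,…,y_m] → ℝ[x_1,…,x_{m+1}]` sending `y_k` to `x_{k+1}`. -/
def shiftVars (m : ℕ) : MvPolynomial (Fin m) ℝ →ₐ[ℝ] MvPolynomial (Fin (m + 1)) ℝ :=
  aeval fun i => X i.succ

lemma xv_add_one {k : ℕ} (hk : k < n) : xv n (k + 1) = X ⟨k, hk⟩ := by
  simp [xv, hk]

lemma X_eq_xv (i : Fin n) : (X i : MvPolynomial (Fin n) ℝ) = xv n (i + 1) := by
  rw [xv_add_one i.2]

lemma identifyVars_xv_one : identifyVars m c (xv (m + 1) 1) = xv m c := by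
  simp [xv_add_one (Nat.succ_pos m), identifyVars]

lemma identifyVars_xv_succ {k : ℕ} (hk : 1 ≤ k) (hkm : k ≤ m) :
    identifyVars m c (xv (m + 1) (k + 1)) = xv m k := by
  simp [xv_add_one (Nat.lt_succ_of_le hkm), identifyVars, show k ≠ 0 by omega]

lemma identifyVars_shiftVars (f : MvPolynomial (Fin m) ℝ) :
    identifyVars m c (shiftVars m f) = f := by
  suffices h : (identifyVars m c).comp (shiftVars m) = AlgHom.id ℝ _ from DFunLike.congr_fun h f
  ext i : 1
  rw [AlgHom.comp_apply, shiftVars, aeval_X, identifyVars, aeval_X, if_neg (by simp)]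
  exact (X_eq_xv i).symm

lemma sub_shiftVars_identifyVars_mem (hc : 1 ≤ c) (hcm : c ≤ m)
    (f : MvPolynomial (Fin (m + 1)) ℝ) :
    f - shiftVars m (identifyVars m c f) ∈
      Ideal.span {xv (m + 1) 1 - xv (m + 1) (c + 1)} := by
  set I := Ideal.span {xv (m + 1) 1 - xv (m + 1) (c + 1)}
  rw [← Ideal.Quotient.eq]
  suffices h : Ideal.Quotient.mkₐ ℝ I =
      ((Ideal.Quotient.mkₐ ℝ I).comp (shiftVars m)).comp (identifyVars m c) from
    DFunLike.congr_fun h f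
  have hsh (k : ℕ) (hk : k < m) : shiftVars m (xv m (k + 1)) = xv (m + 1) (k + 2) := by
    rw [xv_add_one hk, xv_add_one (by omega)]
    simp [shiftVars]
  ext i : 1
  simp only [AlgHom.comp_apply, Ideal.Quotient.mkₐ_eq_mk]
  rw [X_eq_xv]
  obtain hi | hi := Nat.eq_zero_or_pos i.1
  · rw [hi, zero_add, identifyVars_xv_one]
    obtain ⟨e, rfl⟩ := Nat.exists_eq_add_of_le' hc
    rw [hsh e (by omega), Ideal.Quotient.eq]
    exact Ideal.subset_span rfl
  · rw [identifyVars_xv_succ hi (by omega)]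
    obtain ⟨e, he⟩ := Nat.exists_eq_add_of_le' hi
    rw [he, hsh e (by omega)]

lemma prod_Icc_add_one {M : Type*} [CommMonoid M] (f : ℕ → M) (a b : ℕ) :
    ∏ ℓ ∈ Finset.Icc (a + 1) (b + 1), f ℓ = ∏ ℓ ∈ Finset.Icc a b, f (ℓ + 1) := by
  rw [← Finset.map_add_right_Icc, Finset.prod_map]
  rfl

lemma sum_Icc_one_add_one {M : Type*} [AddCommMonoid M] (f : ℕ → M) (b : ℕ) :
    ∑ k ∈ Finset.Icc 1 (b + 1), f k = f 1 + ∑ k ∈ Finset.Icc 1 b, f (k + 1) := by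
  rw [show Finset.Icc 1 (b + 1) = insert 1 (Finset.Icc (1 + 1) (b + 1)) by ext; simp; omega,
    Finset.sum_insert (by simp), ← Finset.map_add_right_Icc, Finset.sum_map]
  rfl

lemma identifyVars_fDnLast (hc : 1 ≤ c) (hcm : c ≤ m) :
    identifyVars m c (fDnLast (m + 1) d11 p1) =
      ((-1 : ℝ) ^ (m + 1) * (p1 : ℝ)) • ∏ ℓ ∈ Finset.Icc 1 m, xv m ℓ := by
  have h1 : ∏ ℓ ∈ Finset.Icc 1 m, (xv m c - identifyVars m c (xv (m + 1) (ℓ + 1))) = 0 :=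
    Finset.prod_eq_zero (Finset.mem_Icc.mpr ⟨hc, hcm⟩)
      (by rw [identifyVars_xv_succ hc hcm, sub_self])
  have h2 : ∏ ℓ ∈ Finset.Icc 1 m, identifyVars m c (xv (m + 1) (ℓ + 1)) =
      ∏ ℓ ∈ Finset.Icc 1 m, xv m ℓ :=
    Finset.prod_congr rfl fun ℓ hℓ => by
      rw [Finset.mem_Icc] at hℓ
      exact identifyVars_xv_succ hℓ.1 hℓ.2
  simp only [fDnLast, map_add, map_smul, map_prod, map_sub, identifyVars_xv_one,
    prod_Icc_add_one _ 1 m, h1, h2, smul_zero, zero_add]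

/-- The data obtained from `d` by identifying the first variable with the `(c+1)`-st one. -/
def mergeData (d : ℕ → ℕ → ℚ) (c : ℕ) (i k : ℕ) : ℚ :=
  d (i + 1) (k + 1) + if k = c then d (i + 1) 1 else 0

lemma identifyVars_fDd (hc : 1 ≤ c) (hcm : c ≤ m) {i : ℕ} (hi : 1 ≤ i) (him : i ≤ m) :
    identifyVars m c (fDd (m + 1) d p (i + 1)) =
      fDd m (mergeData d c) (fun i => p (i + 1)) i := by
  have hx {k : ℕ} (hk : 1 ≤ k) (hkm : k ≤ m) := identifyVars_xv_succ (c := c) hk hkm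
  have hprod (f : MvPolynomial (Fin m) ℝ) :
      ∏ ℓ ∈ Finset.Icc (i + 1) m, (f ^ 2 - identifyVars m c (xv (m + 1) (ℓ + 1)) ^ 2) =
        ∏ ℓ ∈ Finset.Icc (i + 1) m, (f ^ 2 - xv m ℓ ^ 2) :=
    Finset.prod_congr rfl fun ℓ hℓ => by
      rw [Finset.mem_Icc] at hℓ
      rw [hx (by omega) hℓ.2]
  have hprod' : ∏ ℓ ∈ Finset.Icc (i + 1) m, identifyVars m c (xv (m + 1) (ℓ + 1)) ^ 2 =
      ∏ ℓ ∈ Finset.Icc (i + 1) m, xv m ℓ ^ 2 :=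
    Finset.prod_congr rfl fun ℓ hℓ => by
      rw [Finset.mem_Icc] at hℓ
      rw [hx (by omega) hℓ.2]
  rw [fDd, if_neg (by omega), fDd, if_neg (by omega), Nat.add_sub_add_right]
  simp only [map_add, map_sum, map_smul, map_prod, map_sub, map_pow, sum_Icc_one_add_one,
    prod_Icc_add_one _ (i + 1) m, identifyVars_xv_one, hprod, hprod', mergeData]
  congr 1
  have hsum : ∑ k ∈ Finset.Icc 1 i, (d (i + 1) (k + 1) : ℝ) •
      ∏ ℓ ∈ Finset.Icc (i + 1) m, (identifyVars m c (xv (m + 1) (k + 1)) ^ 2 - xv m ℓ ^ 2) =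
      ∑ k ∈ Finset.Icc 1 i, (d (i + 1) (k + 1) : ℝ) •
        ∏ ℓ ∈ Finset.Icc (i + 1) m, (xv m k ^ 2 - xv m ℓ ^ 2) :=
    Finset.sum_congr rfl fun k hk => by
      rw [Finset.mem_Icc] at hk
      rw [hx hk.1 (by omega)]
  rw [hsum, add_comm]
  simp only [Rat.cast_add, add_smul, Finset.sum_add_distrib]
  congr 1
  simp only [apply_ite (Rat.cast : ℚ → ℝ), Rat.cast_zero, ite_smul, zero_smul,
    Finset.sum_ite_eq', Finset.mem_Icc]
  split_ifs with h
  · rfl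
  · rw [Finset.prod_eq_zero (i := c) (Finset.mem_Icc.mpr (by omega)) (sub_self _), smul_zero]

lemma identifyVars_chainForm (hc : 1 ≤ c) (hcm : c ≤ m) :
    identifyVars m c (chainForm (m + 1) d11 (c + 1)) = 0 := by
  rw [chainForm_succ hc, map_mul, map_sub, identifyVars_xv_one, identifyVars_xv_succ hc hcm,
    sub_self, zero_mul]

lemma map_identifyVars_IDhj (hc : 1 ≤ c) (hcm : c ≤ m) (hp1 : p1 ≠ 0) :
    (IDhj (m + 1) d11 p1 d p (c + 1)).map (identifyVars m c) =
      IDn' m (mergeData d c) (fun i => p (i + 1)) := by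
  have hu : (-1 : ℝ) ^ (m + 1) * (p1 : ℝ) ≠ 0 := by simp [hp1]
  rw [IDhj_eq_ofList (by omega) (by omega) (by omega)]
  apply le_antisymm
  · rw [Ideal.map_le_iff_le_comap]
    refine Ideal.span_le.mpr fun f hf => ?_
    simp only [List.cons_append, List.mem_cons, List.mem_append, List.not_mem_nil,
      or_false, Set.mem_ofPred_eq] at hf
    rw [SetLike.mem_coe, Ideal.mem_comap]
    obtain rfl | hf | rfl := hf
    · rw [identifyVars_fDnLast hc hcm, smul_eq_C_mul]
      exact Ideal.mul_mem_left _ _ (Ideal.subset_span (by simp))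
    · obtain ⟨i, h2, hi, rfl⟩ := mem_middleForms.mp hf
      obtain ⟨e, rfl⟩ := Nat.exists_eq_add_of_le' (show 1 ≤ i by omega)
      rw [identifyVars_fDd hc hcm (by omega) (by omega)]
      exact Ideal.subset_span (Or.inr ⟨e, ⟨by omega, by omega⟩, rfl⟩)
    · rw [identifyVars_chainForm hc hcm]
      exact zero_mem _
  · refine Ideal.span_le.mpr ?_
    rintro f (rfl | ⟨i, hi, rfl⟩)
    · have h := Ideal.mem_map_of_mem (identifyVars m c) (Ideal.subset_span (by simp) :
        fDnLast (m + 1) d11 p1 ∈ Ideal.ofList ((fDnLast (m + 1) d11 p1 ::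
          middleForms (m + 1) d p) ++ [chainForm (m + 1) d11 (c + 1)]))
      rw [identifyVars_fDnLast hc hcm, smul_eq_C_mul] at h
      have h' := Ideal.mul_mem_left _ (C ((-1 : ℝ) ^ (m + 1) * (p1 : ℝ))⁻¹) h
      rwa [← mul_assoc, ← map_mul, inv_mul_cancel₀ hu, map_one, one_mul] at h'
    · have hmem := mem_middleForms (n := m + 1) (d := d) (p := p).mpr
        ⟨i + 1, by have := hi.1; omega, by have := hi.1; have := hi.2; omega, rfl⟩
      change fDd m (mergeData d c) (fun i => p (i + 1)) i ∈ _
      rw [← identifyVars_fDd hc hcm hi.1 (by have := hi.2; omega)]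
      exact Ideal.mem_map_of_mem _ (Ideal.subset_span (by simp [hmem]))

lemma identifyVars_mem_iff (hc : 1 ≤ c) (hcm : c ≤ m) (hp1 : p1 ≠ 0)
    {f : MvPolynomial (Fin (m + 1)) ℝ} :
    identifyVars m c f ∈ IDn' m (mergeData d c) (fun i => p (i + 1)) ↔
      ∃ g, f - (xv (m + 1) 1 - xv (m + 1) (c + 1)) * g ∈ IDhj (m + 1) d11 p1 d p (c + 1) := by
  rw [← map_identifyVars_IDhj (d11 := d11) hc hcm hp1]
  constructor
  · intro hf
    obtain ⟨e, he, hef⟩ := (Ideal.mem_map_iff_of_surjective _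
      fun y => ⟨_, identifyVars_shiftVars y⟩).mp hf
    have h := sub_shiftVars_identifyVars_mem hc hcm (f - e)
    rw [map_sub, hef, sub_self, map_zero, sub_zero, Ideal.mem_span_singleton'] at h
    obtain ⟨g, hg⟩ := h
    refine ⟨g, ?_⟩
    rwa [mul_comm, hg, sub_sub_cancel]
  · rintro ⟨g, hg⟩
    have h := Ideal.mem_map_of_mem (identifyVars m c) hg
    rwa [map_sub, map_mul, map_sub, identifyVars_xv_one, identifyVars_xv_succ hc hcm, sub_self,
      zero_mul, sub_zero] at h

end ExactSequence

/-- **The exact sequence (5.30).** For `2 ≤ j ≤ n`, if `R^{D}_{h_{j−1}}` and `R^{D}_{h_j}`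
are Artinian, multiplication by `x_1−x_j` induces a well-defined injective ℝ-linear map
`R^{D}_{h_{j−1}} → R^{D}_{h_j}` whose cokernel is isomorphic to a ring `R^{D'_{(n−1)}}`
in `n−1` variables; i.e. `0 → R^{D}_{h_{j−1}} → R^{D}_{h_j} → R^{D'_{(n−1)}} → 0` is
exact. -/
theorem stmt_13 (n : ℕ) (hn : 2 ≤ n) (d11 p1 : ℚ) (d : ℕ → ℕ → ℚ) (p : ℕ → ℚ)
    (j : ℕ) (hj2 : 2 ≤ j) (hjn : j ≤ n)
    (hart1 : FiniteDimensional ℝ (MvPolynomial (Fin n) ℝ ⧸ IDhj n d11 p1 d p (j - 1)))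
    (hart2 : FiniteDimensional ℝ (MvPolynomial (Fin n) ℝ ⧸ IDhj n d11 p1 d p j)) :
    ∃ (d' : ℕ → ℕ → ℚ) (p' : ℕ → ℚ),
      ∃ (φ : (MvPolynomial (Fin n) ℝ ⧸ IDhj n d11 p1 d p (j - 1)) →ₗ[ℝ]
            (MvPolynomial (Fin n) ℝ ⧸ IDhj n d11 p1 d p j))
        (ψ : (MvPolynomial (Fin n) ℝ ⧸ IDhj n d11 p1 d p j) →ₐ[ℝ]
            (MvPolynomial (Fin (n - 1)) ℝ ⧸ IDn' (n - 1) d' p')),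
        (∀ f : MvPolynomial (Fin n) ℝ,
          φ (Ideal.Quotient.mk (IDhj n d11 p1 d p (j - 1)) f) =
            Ideal.Quotient.mk (IDhj n d11 p1 d p j) ((xv n 1 - xv n j) * f)) ∧
        Function.Injective φ ∧
        Function.Surjective ψ ∧
        LinearMap.range φ = LinearMap.ker ψ.toLinearMap := by
  obtain ⟨m, rfl⟩ := Nat.exists_eq_add_of_le' (show 1 ≤ n by omega)
  obtain ⟨c, rfl⟩ := Nat.exists_eq_add_of_le' (show 1 ≤ j by omega)
  have hc : 1 ≤ c := by omega
  have hcm : c ≤ m := by omega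
  have hmul {f : MvPolynomial (Fin (m + 1)) ℝ} :=
    mul_mem_IDhj_iff (n := m + 1) (d11 := d11) (p1 := p1) (d := d) (p := p) hn hc hjn (f := f)
  have hker {f : MvPolynomial (Fin (m + 1)) ℝ} :=
    identifyVars_mem_iff (d11 := d11) (d := d) (p := p) hc hcm
      (p1_ne_zero (d11 := d11) (p1 := p1) (d := d) (p := p) hn hc hjn) (f := f)
  let φ : (MvPolynomial (Fin (m + 1)) ℝ ⧸ IDhj (m + 1) d11 p1 d p c) →ₗ[ℝ]
      (MvPolynomial (Fin (m + 1)) ℝ ⧸ IDhj (m + 1) d11 p1 d p (c + 1)) :=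
    (Submodule.mapQ (IDhj (m + 1) d11 p1 d p c) (IDhj (m + 1) d11 p1 d p (c + 1))
      (LinearMap.mulLeft _ (xv (m + 1) 1 - xv (m + 1) (c + 1)))
      fun f hf => hmul.mpr hf).restrictScalars ℝ
  let ψ : (MvPolynomial (Fin (m + 1)) ℝ ⧸ IDhj (m + 1) d11 p1 d p (c + 1)) →ₐ[ℝ]
      (MvPolynomial (Fin m) ℝ ⧸ IDn' m (mergeData d c) (fun i => p (i + 1))) :=
    Ideal.Quotient.liftₐ _ ((Ideal.Quotient.mkₐ ℝ _).comp (identifyVars m c)) fun f hf =>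
      Ideal.Quotient.eq_zero_iff_mem.mpr (hker.mpr ⟨0, by simpa using hf⟩)
  have hφ (f : MvPolynomial (Fin (m + 1)) ℝ) : φ (Ideal.Quotient.mk _ f) =
      Ideal.Quotient.mk _ ((xv (m + 1) 1 - xv (m + 1) (c + 1)) * f) := rfl
  have hψ (f : MvPolynomial (Fin (m + 1)) ℝ) : ψ (Ideal.Quotient.mk _ f) =
      Ideal.Quotient.mk _ (identifyVars m c f) := rfl
  suffices h : Function.Injective φ ∧ Function.Surjective ψ ∧
      LinearMap.range φ = LinearMap.ker ψ.toLinearMap from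
    ⟨mergeData d c, fun i => p (i + 1), φ, ψ, hφ, h⟩
  refine ⟨?_, ?_, ?_⟩
  · rw [injective_iff_map_eq_zero]
    intro a ha
    obtain ⟨f, rfl⟩ := Ideal.Quotient.mk_surjective a
    rw [hφ, Ideal.Quotient.eq_zero_iff_mem] at ha
    exact Ideal.Quotient.eq_zero_iff_mem.mpr (hmul.mp ha)
  · intro a
    obtain ⟨f, rfl⟩ := Ideal.Quotient.mk_surjective a
    exact ⟨Ideal.Quotient.mk _ (shiftVars m f), by rw [hψ, identifyVars_shiftVars]⟩
  · ext a
    obtain ⟨f, rfl⟩ := Ideal.Quotient.mk_surjective a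
    rw [LinearMap.mem_ker, AlgHom.toLinearMap_apply, hψ, Ideal.Quotient.eq_zero_iff_mem, hker,
      LinearMap.mem_range]
    constructor
    · rintro ⟨b, hb⟩
      obtain ⟨g, rfl⟩ := Ideal.Quotient.mk_surjective b
      exact ⟨g, Ideal.Quotient.eq.mp (hb.symm.trans (hφ g))⟩
    · rintro ⟨g, hg⟩
      exact ⟨Ideal.Quotient.mk _ g, (Ideal.Quotient.eq.mpr hg).symm⟩
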